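/- arXiv:1307.2688 — 2 statements merged into one kernel-verified Lean document; each statement's English description precedes it below -/
import Mathlib

section
/- There exists a constant C such that every finite simple graph G that admits a proper 3-coloring, equipped with any weight function d : V(G) → ℕ, has a proper multicoloring using at most ⌈(3/2)·ω(G)⌉ + C colors; in particular χ_m(G) ≤ ⌈(3/2)·ω(G)⌉ + C. -/
/-- A proper multicoloring of the weighted graph `(G, d)` with `n` colors: each vertex `v`
receives a set of at least `d v` of the `n` colors, and adjacent vertices receive
disjoint sets. -/
def HasMulticoloring {V : Type*} (G : SimpleGraph V) (d : V → ℕ) (n : ℕ) : Prop :=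
  ∃ f : V → Finset (Fin n),
    (∀ v, d v ≤ (f v).card) ∧ ∀ u v, G.Adj u v → Disjoint (f u) (f v)

/-- The multichromatic number: the least `n` admitting a proper multicoloring. -/
noncomputable def multichromaticNumber {V : Type*} (G : SimpleGraph V) (d : V → ℕ) : ℕ :=
  sInf {n : ℕ | HasMulticoloring G d n}

/-- The weighted clique number of `(G, d)`: the maximum over all cliques `K` of `G` of
`Σ_{v ∈ K} d v`. -/
noncomputable def cliqueNumW {V : Type*} (G : SimpleGraph V) (d : V → ℕ) : ℕ :=
  sSup {n : ℕ | ∃ K : Finset V, G.IsClique (K : Set V) ∧ n = ∑ v ∈ K, d v}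

theorem HasMulticoloring.of_card_le {V α : Type*} [Fintype α] {G : SimpleGraph V} {d : V → ℕ}
    {n : ℕ} (hn : Fintype.card α ≤ n) (f : V → Finset α) (hd : ∀ v, d v ≤ (f v).card)
    (hf : ∀ u v, G.Adj u v → Disjoint (f u) (f v)) : HasMulticoloring G d n := by
  obtain ⟨e⟩ : Nonempty (α ↪ Fin n) :=
    Function.Embedding.nonempty_of_card_le (by simpa using hn)
  exact ⟨fun v => (f v).map e, fun v => by simpa using hd v,
    fun u v h => (Finset.disjoint_map e).2 (hf u v h)⟩

theorem sum_le_cliqueNumW {V : Type*} [Fintype V] {G : SimpleGraph V} (d : V → ℕ)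
    {K : Finset V} (hK : G.IsClique (K : Set V)) : ∑ v ∈ K, d v ≤ cliqueNumW G d := by
  refine le_csSup ⟨∑ v, d v, ?_⟩ ⟨K, hK, rfl⟩
  rintro _ ⟨L, -, rfl⟩
  exact Finset.sum_le_sum_of_subset (Finset.subset_univ L)

theorem le_cliqueNumW {V : Type*} [Fintype V] (G : SimpleGraph V) (d : V → ℕ) (v : V) :
    d v ≤ cliqueNumW G d := by
  simpa using sum_le_cliqueNumW (G := G) d (K := {v}) (by simp)

theorem add_le_cliqueNumW_of_adj {V : Type*} [Fintype V] {G : SimpleGraph V} (d : V → ℕ)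
    {u v : V} (h : G.Adj u v) : d u + d v ≤ cliqueNumW G d := by
  classical
  rw [← Finset.sum_pair h.ne]
  refine sum_le_cliqueNumW d ?_
  simpa [SimpleGraph.isClique_pair] using fun _ => h

/-- The colors used by a vertex of class `c` and weight `m` when each of the three classes owns
`k` colors: the first `m` colors of its own class, and the last `m - k` colors of the next one. -/
def borrowedPalette (k : ℕ) (c : Fin 3) (m : ℕ) : Finset (Fin 3 × Fin k) :=
  Finset.univ.filter fun p => (p.1 = c ∧ (p.2 : ℕ) < m) ∨ (p.1 = c + 1 ∧ 2 * k ≤ m + p.2)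

theorem le_card_borrowedPalette {k m : ℕ} (c : Fin 3) (hm : m ≤ 2 * k) :
    m ≤ (borrowedPalette k c m).card := by
  let g : Fin m → Fin 3 × Fin k := fun i =>
    if h : (i : ℕ) < k then (c, ⟨i, h⟩) else (c + 1, ⟨2 * k - 1 - i, by omega⟩)
  have hc : c ≠ c + 1 := by revert c; decide
  have hg : Function.Injective g := by
    intro i j hij
    simp only [g] at hij
    split_ifs at hij <;> simp_all [Prod.ext_iff, Fin.ext_iff]
    omega
  calc m = (Finset.univ.image g).card := by simp [Finset.card_image_of_injective _ hg]
    _ ≤ _ := by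
      refine Finset.card_le_card fun p hp => ?_
      obtain ⟨i, -, rfl⟩ := Finset.mem_image.1 hp
      simp only [borrowedPalette, Finset.mem_filter, Finset.mem_univ, true_and, g]
      split_ifs
      · exact Or.inl ⟨rfl, i.2⟩
      · exact Or.inr ⟨rfl, by dsimp only; omega⟩

theorem disjoint_borrowedPalette {k m n : ℕ} {a b : Fin 3} (hab : a ≠ b)
    (h : m + n ≤ 2 * k) : Disjoint (borrowedPalette k a m) (borrowedPalette k b n) := by
  rw [Finset.disjoint_left]
  rintro ⟨x, j⟩ hm hn
  simp only [borrowedPalette, Finset.mem_filter, Finset.mem_univ, true_and] at hm hn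
  rcases hm with ⟨h₁, h₂⟩ | ⟨h₁, h₂⟩ <;> rcases hn with ⟨h₃, h₄⟩ | ⟨h₃, h₄⟩
  · exact hab (h₁.symm.trans h₃)
  · omega
  · omega
  · exact hab (add_right_cancel (h₁.symm.trans h₃))

/-- There is a constant `C` such that every finite simple graph admitting a proper
3-coloring, with any weights `d`, has a proper multicoloring with at most
`⌈(3/2)·ω(G)⌉ + C` colors; in particular `χ_m(G) ≤ ⌈(3/2)·ω(G)⌉ + C`.
(In `ℕ`, `⌈(3/2)·w⌉ = (3*w + 1)/2`.) -/
theorem three_colorable_multicoloring :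
    ∃ C : ℕ, ∀ (V : Type) [Fintype V], ∀ (G : SimpleGraph V) (d : V → ℕ),
      (∃ c : V → Fin 3, ∀ u v, G.Adj u v → c u ≠ c v) →
      HasMulticoloring G d ((3 * cliqueNumW G d + 1) / 2 + C) ∧
        multichromaticNumber G d ≤ (3 * cliqueNumW G d + 1) / 2 + C := by
  refine ⟨1, fun V _ G d ⟨c, hc⟩ => ?_⟩
  suffices h : HasMulticoloring G d ((3 * cliqueNumW G d + 1) / 2 + 1) from ⟨h, Nat.sInf_le h⟩
  let k := (cliqueNumW G d + 1) / 2
  have hk : cliqueNumW G d ≤ 2 * k := by omega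
  refine .of_card_le (α := Fin 3 × Fin k) ?_ (fun v => borrowedPalette k (c v) (d v))
    (fun v => le_card_borrowedPalette _ ((le_cliqueNumW G d v).trans hk))
    (fun u v huv => disjoint_borrowedPalette (hc u v huv)
      ((add_le_cliqueNumW_of_adj d huv).trans hk))
  simp only [Fintype.card_prod, Fintype.card_fin]
  omega
end

section
/- Every finite simple triangle-free graph with maximum degree at most 3 admits a proper 3-coloring of its vertices. -/
namespace SimpleGraph

variable {V : Type*} {G : SimpleGraph V}

/-- `c` is a proper coloring of the subgraph of `G` induced on `A`. -/
def ProperOn (G : SimpleGraph V) (A : Finset V) (c : V → Fin 3) : Prop :=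
  ∀ u ∈ A, ∀ v ∈ A, G.Adj u v → c u ≠ c v

theorem ProperOn.mono {A B : Finset V} {c : V → Fin 3} (h : G.ProperOn B c) (hAB : A ⊆ B) :
    G.ProperOn A c :=
  fun u hu v hv => h u (hAB hu) v (hAB hv)

open Classical in
theorem ProperOn.update {A : Finset V} {c : V → Fin 3} (hc : G.ProperOn A c) {v : V} (hv : v ∉ A)
    {x : Fin 3} (hx : ∀ u ∈ A, G.Adj v u → c u ≠ x) :
    G.ProperOn (insert v A) (Function.update c v x) := by
  intro a ha b hb hab
  have hne := hab.ne
  rcases Finset.mem_insert.1 ha with rfl | ha'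
  · rcases Finset.mem_insert.1 hb with rfl | hb'
    · exact absurd rfl hne
    · rw [Function.update_self, Function.update_of_ne hne.symm]
      exact (hx b hb' hab).symm
  · have hav : a ≠ v := fun h => hv (h ▸ ha')
    rw [Function.update_of_ne hav]
    rcases Finset.mem_insert.1 hb with rfl | hb'
    · rw [Function.update_self]
      exact hx a ha' hab.symm
    · have hbv : b ≠ v := fun h => hv (h ▸ hb')
      rw [Function.update_of_ne hbv]
      exact hc a ha' b hb' hab

variable [Fintype V] [DecidableRel G.Adj]

open Classical in
/-- A vertex whose colored neighbors use at most two colors can be colored. -/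
theorem ProperOn.exists_insert {A : Finset V} {c : V → Fin 3} (hc : G.ProperOn A c) {v : V}
    (hv : v ∉ A) (hcard : ((G.neighborFinset v ∩ A).image c).card < 3) :
    ∃ c', G.ProperOn (insert v A) c' ∧ ∀ a ∈ A, c' a = c a := by
  obtain ⟨x, hx⟩ : ∃ x, x ∉ (G.neighborFinset v ∩ A).image c := by
    by_contra! h
    rw [Finset.eq_univ_iff_forall.2 h] at hcard
    simp at hcard
  refine ⟨Function.update c v x, hc.update hv fun u hu huv h => hx ?_, fun a ha => ?_⟩
  · exact Finset.mem_image.2 ⟨u, by simp [hu, huv], h⟩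
  · have hav : a ≠ v := fun h => hv (h ▸ ha)
    exact Function.update_of_ne hav _ _

open Classical in
/-- A vertex with an uncolored neighbor can be colored. -/
theorem ProperOn.exists_insert_of_adj (hdeg : ∀ v, G.degree v ≤ 3) {A : Finset V} {c : V → Fin 3}
    (hc : G.ProperOn A c) {v u : V} (hv : v ∉ A) (hvu : G.Adj v u) (hu : u ∉ A) :
    ∃ c', G.ProperOn (insert v A) c' ∧ ∀ a ∈ A, c' a = c a := by
  refine hc.exists_insert hv (Finset.card_image_le.trans_lt ?_)
  refine lt_of_lt_of_le (Finset.card_lt_card ?_) (hdeg v)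
  refine Finset.ssubset_iff_subset_ne.2 ⟨Finset.inter_subset_left, fun h => hu ?_⟩
  have : u ∈ G.neighborFinset v ∩ A := by rw [h]; simpa using hvu
  exact (Finset.mem_inter.1 this).2

open Classical in
/-- A vertex with two neighbors of the same color can be colored. -/
theorem ProperOn.exists_insert_of_color_eq (hdeg : ∀ v, G.degree v ≤ 3) {A : Finset V}
    {c : V → Fin 3} (hc : G.ProperOn A c) {v y z : V} (hv : v ∉ A) (hvy : G.Adj v y)
    (hvz : G.Adj v z) (hyz : y ≠ z) (hcyz : c y = c z) :
    ∃ c', G.ProperOn (insert v A) c' ∧ ∀ a ∈ A, c' a = c a := by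
  refine hc.exists_insert hv ?_
  have hsub : (G.neighborFinset v ∩ A).image c ⊆ ((G.neighborFinset v).erase y).image c := by
    intro x hx
    obtain ⟨u, hu, rfl⟩ := Finset.mem_image.1 hx
    have hu' := (Finset.mem_inter.1 hu).1
    by_cases huy : u = y
    · exact Finset.mem_image.2 ⟨z, by simp [hyz.symm, hvz], by rw [huy, hcyz]⟩
    · exact Finset.mem_image.2 ⟨u, Finset.mem_erase.2 ⟨huy, hu'⟩, rfl⟩
  have h1 := Finset.card_le_card hsub
  have h2 : (((G.neighborFinset v).erase y).image c).card ≤ _ := Finset.card_image_le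
  have h3 : ((G.neighborFinset v).erase y).card < (G.neighborFinset v).card :=
    Finset.card_erase_lt_of_mem (by simpa using hvy)
  have h4 := hdeg v
  rw [← G.card_neighborFinset_eq_degree] at h4
  omega

open Classical in
/-- Greedy coloring in order of decreasing rank, when each vertex to be colored has a neighbor
of smaller rank that is still uncolored. -/
theorem ProperOn.exists_union_of_rank (hdeg : ∀ v, G.degree v ≤ 3) (ρ : V → ℕ) (T : Finset V) :
    ∀ (A : Finset V) (c : V → Fin 3), G.ProperOn A c → Disjoint A T →
      (∀ v ∈ T, ∃ u, G.Adj v u ∧ u ∉ A ∧ ρ u < ρ v) →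
      ∃ c', G.ProperOn (A ∪ T) c' ∧ ∀ a ∈ A, c' a = c a := by
  induction T using Finset.induction_on_max_value ρ with
  | empty => exact fun A c hc _ _ => ⟨c, by simpa using hc, fun _ _ => rfl⟩
  | insert v T hvT hmax ih =>
    intro A c hc hdisj hT
    rw [Finset.disjoint_insert_right] at hdisj
    obtain ⟨u, hvu, huA, -⟩ := hT v (Finset.mem_insert_self _ _)
    obtain ⟨c₁, hc₁, hcc₁⟩ := hc.exists_insert_of_adj hdeg hdisj.1 hvu huA
    obtain ⟨c₂, hc₂, hcc₂⟩ := ih (insert v A) c₁ hc₁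
      (Finset.disjoint_insert_left.2 ⟨hvT, hdisj.2⟩) (by
        intro t ht
        obtain ⟨s, hts, hsA, hst⟩ := hT t (Finset.mem_insert_of_mem ht)
        refine ⟨s, hts, fun h => ?_, hst⟩
        rcases Finset.mem_insert.1 h with rfl | h
        · exact absurd (hmax t ht) (by omega)
        · exact hsA h)
    refine ⟨c₂, hc₂.mono fun x => ?_, fun a ha => ?_⟩
    · simp only [Finset.mem_union, Finset.mem_insert]
      tauto
    · rw [hcc₂ a (Finset.mem_insert_of_mem ha), hcc₁ a ha]

open Classical in
/-- Greedy coloring towards a root that has two neighbors of the same color. -/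
theorem ProperOn.exists_of_root (hdeg : ∀ v, G.degree v ≤ 3) (ρ : V → ℕ) {S A : Finset V}
    {c : V → Fin 3} (hc : G.ProperOn A c) {r y z : V} (hr : r ∉ A) (hy : y ∈ A) (hz : z ∈ A)
    (hry : G.Adj r y) (hrz : G.Adj r z) (hyz : y ≠ z) (hcyz : c y = c z)
    (hρ : ∀ v ∈ S, v ∉ A → v ≠ r → ∃ u, G.Adj v u ∧ u ∉ A ∧ ρ u < ρ v) :
    ∃ c', G.ProperOn S c' := by
  obtain ⟨c₁, hc₁, hcc₁⟩ := ProperOn.exists_union_of_rank hdeg ρ ((S \ A).erase r) A c hc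
    (Finset.disjoint_left.2 fun a ha h => by simp [ha] at h)
    (fun v hv => by
      simp only [Finset.mem_erase, Finset.mem_sdiff] at hv
      exact hρ v hv.2.1 hv.2.2 hv.1)
  obtain ⟨c₂, hc₂, -⟩ := hc₁.exists_insert_of_color_eq hdeg (v := r) (by simp [hr]) hry hrz hyz
    (by rw [hcc₁ y hy, hcc₁ z hz, hcyz])
  refine ⟨c₂, hc₂.mono fun x hx => ?_⟩
  simp only [Finset.mem_insert, Finset.mem_union, Finset.mem_erase, Finset.mem_sdiff]
  tauto

omit [DecidableRel G.Adj] in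
/-- In a nonempty set closed under adjacency there is a path containing all neighbors of its
initial vertex. -/
theorem exists_path_neighbors_mem {S : Finset V} (hS : S.Nonempty)
    (hclosed : ∀ v ∈ S, ∀ u, G.Adj v u → u ∈ S) :
    ∃ (w : ℕ → V) (m : ℕ), (∀ i ≤ m, w i ∈ S) ∧ (∀ i ≤ m, ∀ j ≤ m, w i = w j → i = j) ∧
      (∀ i < m, G.Adj (w i) (w (i + 1))) ∧ ∀ u, G.Adj (w 0) u → ∃ i ≤ m, u = w i := by
  by_contra! hcon
  have key : ∀ m : ℕ, ∃ w : ℕ → V, (∀ i ≤ m, w i ∈ S) ∧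
      (∀ i ≤ m, ∀ j ≤ m, w i = w j → i = j) ∧ (∀ i < m, G.Adj (w i) (w (i + 1))) := by
    intro m
    induction m with
    | zero =>
      obtain ⟨s, hs⟩ := hS
      exact ⟨fun _ => s, fun _ _ => hs, fun i hi j hj _ => by omega, fun i hi => by omega⟩
    | succ m ih =>
      obtain ⟨w, hwS, hinj, hadj⟩ := ih
      obtain ⟨u, hu, hne⟩ := hcon w m hwS hinj hadj
      refine ⟨fun n => Nat.casesOn n u w, ?_, ?_, ?_⟩
      · rintro (_ | i) hi
        · exact hclosed _ (hwS 0 (Nat.zero_le _)) _ hu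
        · exact hwS i (by omega)
      · rintro (_ | i) hi (_ | j) hj h
        · rfl
        · exact absurd h (hne j (by omega))
        · exact absurd h.symm (hne i (by omega))
        · rw [hinj i (by omega) j (by omega) h]
      · rintro (_ | i) hi
        · exact hu.symm
        · exact hadj i (by omega)
  obtain ⟨w, -, hinj, -⟩ := key (Fintype.card V)
  have : Function.Injective fun i : Fin (Fintype.card V + 1) => w i := fun i j h =>
    Fin.ext (hinj i (by omega) j (by omega) h)
  have := Fintype.card_le_of_injective _ this
  simp at this

open Classical in
/-- A coloring of the complement of a cycle extends to the cycle, provided the initial vertex of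
the cycle has all its neighbors on the cycle, and one of them spans a chord. -/
theorem exists_properOn_of_cycle (htf : G.CliqueFree 3) (hdeg : ∀ v, G.degree v ≤ 3)
    {S C : Finset V} {w : ℕ → V} {m k : ℕ} (hC : ∀ v, v ∈ C ↔ ∃ i ≤ m, v = w i)
    (hinj : ∀ i ≤ m, ∀ j ≤ m, w i = w j → i = j)
    (hadj : ∀ i < m, G.Adj (w i) (w (i + 1))) (hcyc : G.Adj (w 0) (w m))
    (hk1 : 1 < k) (hkm : k < m) (hchord : G.Adj (w 0) (w k))
    (h0 : ∀ u, G.Adj (w 0) u → u ∈ C) {c : V → Fin 3} (hc : G.ProperOn (S \ C) c) :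
    ∃ c', G.ProperOn S c' := by
  have hwC : ∀ i ≤ m, w i ∈ C := fun i hi => (hC _).2 ⟨i, hi, rfl⟩
  have hwne : ∀ i ≤ m, ∀ j ≤ m, i ≠ j → w i ≠ w j := fun i hi j hj hij h => hij (hinj i hi j hj h)
  have hρ : ∀ f : ℕ → ℕ, ∃ ρ : V → ℕ, ∀ i ≤ m, ρ (w i) = f i := by
    intro f
    refine ⟨fun v => if h : ∃ i ≤ m, v = w i then f h.choose else 0, fun i hi => ?_⟩
    have h : ∃ j ≤ m, w i = w j := ⟨i, hi, rfl⟩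
    simp only [dif_pos h]
    rw [← hinj i hi _ h.choose_spec.1 h.choose_spec.2]
  by_cases hout : ∃ i, i ≤ m ∧ ∃ u ∈ S \ C, G.Adj (w i) u
  · obtain ⟨hnm, u, hu, hnu⟩ := Nat.find_spec hout
    have hmin := fun i => Nat.find_min hout (m := i)
    generalize Nat.find hout = n at hnm hnu hmin
    have huC := (Finset.mem_sdiff.1 hu).2
    obtain _ | n := n
    · exact absurd (h0 u hnu) huC
    have hn : w n ∉ S \ C := by simp [hwC n (by omega)]
    have hc₁ := hc.update hn (x := c u) fun a ha hna =>
      absurd ⟨by omega, a, ha, hna⟩ (hmin n (by omega))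
    obtain ⟨ρ, hρ⟩ := hρ fun t => if n < t then t else m + 1 + t
    have hnot : ∀ t ≤ m, t ≠ n → w t ∉ insert (w n) (S \ C) := fun t ht htn => by
      simp [hwC t ht, hwne t ht n (by omega) htn]
    have hune : u ≠ w n := fun h => hn (h ▸ hu)
    refine hc₁.exists_of_root hdeg ρ (r := w (n + 1)) (y := u) (z := w n)
      (hnot _ hnm (by omega)) (Finset.mem_insert_of_mem hu) (Finset.mem_insert_self _ _) hnu
      (hadj n (by omega)).symm hune (by rw [Function.update_of_ne hune, Function.update_self]) ?_
    intro v hvS hvA hvr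
    have hvC : v ∈ C := by
      by_contra h
      exact hvA (Finset.mem_insert_of_mem (Finset.mem_sdiff.2 ⟨hvS, h⟩))
    obtain ⟨t, ht, rfl⟩ := (hC v).1 hvC
    have htn : t ≠ n := by rintro rfl; exact hvA (Finset.mem_insert_self _ _)
    have htn1 : t ≠ n + 1 := by rintro rfl; exact hvr rfl
    obtain _ | t := t
    · refine ⟨w m, hcyc, hnot m le_rfl (by omega), ?_⟩
      rw [hρ _ ht, hρ _ le_rfl, if_pos (by omega), if_neg (by omega)]
      omega
    · refine ⟨w t, (hadj t (by omega)).symm, hnot t (by omega) (by omega), ?_⟩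
      rw [hρ _ ht, hρ _ (by omega)]
      split_ifs <;> omega
  · push Not at hout
    have h1 : w 1 ∉ S \ C := by simp [hwC 1 (by omega)]
    have hm1 : w m ≠ w 1 := hwne m le_rfl 1 (by omega) (by omega)
    have hc₁ := hc.update h1 (x := 0) fun a ha h => absurd h (hout 1 (by omega) a ha)
    have hm : w m ∉ insert (w 1) (S \ C) := by simp [hwC m le_rfl, hm1]
    have hnadj : ¬ G.Adj (w m) (w 1) := fun h =>
      htf {w 0, w 1, w m} (is3Clique_triple_iff.2 ⟨hadj 0 (by omega), hcyc, h.symm⟩)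
    have hc₂ := hc₁.update hm (x := 0) fun a ha h => by
      rcases Finset.mem_insert.1 ha with rfl | ha
      · exact absurd h hnadj
      · exact absurd h (hout m le_rfl a ha)
    obtain ⟨ρ, hρ⟩ := hρ fun t => if t = 0 then 0 else 1 + (t - k) + (k - t)
    have hnot : ∀ t ≤ m, t ≠ 1 → t ≠ m → w t ∉ insert (w m) (insert (w 1) (S \ C)) :=
      fun t ht ht1 htm => by
        simp [hwC t ht, hwne t ht 1 (by omega) ht1, hwne t ht m le_rfl htm]
    refine hc₂.exists_of_root hdeg ρ (r := w 0) (y := w 1) (z := w m)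
      (hnot 0 (by omega) (by omega) (by omega)) (by simp) (by simp) (hadj 0 (by omega)) hcyc
      hm1.symm (by rw [Function.update_of_ne hm1.symm, Function.update_self,
        Function.update_self]) ?_
    intro v hvS hvA hvr
    have hvC : v ∈ C := by
      by_contra h
      exact hvA (by simp [hvS, h])
    obtain ⟨t, ht, rfl⟩ := (hC v).1 hvC
    have ht0 : t ≠ 0 := by rintro rfl; exact hvr rfl
    have ht1 : t ≠ 1 := by rintro rfl; exact hvA (by simp)
    have htm : t ≠ m := by rintro rfl; exact hvA (by simp)
    rcases lt_trichotomy t k with htk | rfl | htk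
    · refine ⟨w (t + 1), hadj t (by omega), hnot _ (by omega) (by omega) (by omega), ?_⟩
      rw [hρ _ ht, hρ _ (by omega), if_neg (by omega), if_neg (by omega)]
      omega
    · refine ⟨w 0, hchord.symm, hnot _ (by omega) (by omega) (by omega), ?_⟩
      rw [hρ _ ht, hρ _ (by omega), if_pos rfl, if_neg (by omega)]
      omega
    · obtain ⟨t, rfl⟩ := Nat.exists_eq_succ_of_ne_zero ht0
      refine ⟨w t, (hadj t (by omega)).symm, hnot _ (by omega) (by omega) (by omega), ?_⟩
      rw [hρ _ ht, hρ _ (by omega), if_neg (by omega), if_neg (by omega)]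
      omega

open Classical in
theorem exists_properOn (htf : G.CliqueFree 3) (hdeg : ∀ v, G.degree v ≤ 3) (S : Finset V) :
    ∃ c, G.ProperOn S c := by
  induction S using Finset.strongInduction with
  | H S ih =>
  obtain rfl | hS := S.eq_empty_or_nonempty
  · exact ⟨fun _ => 0, fun u hu => by simp at hu⟩
  by_cases hlow : ∃ v ∈ S, (G.neighborFinset v ∩ S.erase v).card < 3
  · obtain ⟨v, hv, hcard⟩ := hlow
    obtain ⟨c, hc⟩ := ih _ (Finset.erase_ssubset hv)
    obtain ⟨c', hc', -⟩ := hc.exists_insert (Finset.notMem_erase v S)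
      (Finset.card_image_le.trans_lt hcard)
    exact ⟨c', by rwa [Finset.insert_erase hv] at hc'⟩
  push Not at hlow
  have hclosed : ∀ v ∈ S, ∀ u, G.Adj v u → u ∈ S := by
    intro v hv u hvu
    have h := Finset.eq_of_subset_of_card_le
      (Finset.inter_subset_left (s₁ := G.neighborFinset v) (s₂ := S.erase v))
      ((hdeg v).trans (hlow v hv))
    have hu : u ∈ G.neighborFinset v ∩ S.erase v := by rw [h]; simpa using hvu
    exact Finset.mem_of_mem_erase (Finset.mem_inter.1 hu).2
  obtain ⟨w, M, hwS, hinj, hadj, h0⟩ := exists_path_neighbors_mem hS hclosed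
  have hcard : 3 ≤ (G.neighborFinset (w 0)).card :=
    (hlow _ (hwS 0 (Nat.zero_le _))).trans (Finset.card_le_card Finset.inter_subset_left)
  let I := (Finset.range (M + 1)).filter fun i => G.Adj (w 0) (w i)
  have hI : I.Nonempty := by
    obtain ⟨u, hu⟩ := Finset.card_pos.1 (by omega : 0 < (G.neighborFinset (w 0)).card)
    have hu : G.Adj (w 0) u := by simpa using hu
    obtain ⟨i, hi, rfl⟩ := h0 u hu
    exact ⟨i, by simp [I, hu]; omega⟩
  obtain ⟨hmM, hcyc⟩ : I.max' hI ≤ M ∧ G.Adj (w 0) (w (I.max' hI)) := by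
    have h := Finset.mem_filter.1 (I.max'_mem hI)
    exact ⟨Nat.lt_succ_iff.1 (Finset.mem_range.1 h.1), h.2⟩
  have hmax : ∀ u, G.Adj (w 0) u → ∃ i ≤ I.max' hI, u = w i := by
    intro u hu
    obtain ⟨i, hi, rfl⟩ := h0 u hu
    exact ⟨i, I.le_max' _ (by simp [I, hu]; omega), rfl⟩
  generalize I.max' hI = m at hmM hcyc hmax
  obtain ⟨u, hu, hne⟩ : ∃ u ∈ G.neighborFinset (w 0), u ∉ ({w 1, w m} : Finset V) :=
    Finset.exists_mem_notMem_of_card_lt_card (Finset.card_le_two.trans_lt hcard)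
  have hu : G.Adj (w 0) u := by simpa using hu
  obtain ⟨k, hkm, rfl⟩ := hmax u hu
  have hk0 : k ≠ 0 := by rintro rfl; exact hu.ne rfl
  have hk1 : k ≠ 1 := by rintro rfl; simp at hne
  have hkm' : k ≠ m := by rintro rfl; simp at hne
  let C := (Finset.range (m + 1)).image w
  have hC : ∀ v, v ∈ C ↔ ∃ i ≤ m, v = w i := fun v => by
    simp only [C, Finset.mem_image, Finset.mem_range, Nat.lt_succ_iff, eq_comm]
  obtain ⟨c, hc⟩ := ih (S \ C) (Finset.ssubset_iff_of_subset Finset.sdiff_subset |>.2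
    ⟨w 0, hwS 0 (Nat.zero_le _), by simp [(hC (w 0)).2 ⟨0, Nat.zero_le _, rfl⟩]⟩)
  exact exists_properOn_of_cycle htf hdeg hC
    (fun i hi j hj => hinj i (by omega) j (by omega)) (fun i hi => hadj i (by omega)) hcyc
    (by omega) (by omega) hu (fun u hu => (hC u).2 (hmax u hu)) hc

end SimpleGraph

/-- Every finite simple triangle-free graph with maximum degree at most 3 admits a
proper 3-coloring of its vertices. -/
theorem triangle_free_max_degree_three_colorable {V : Type*} [Fintype V]
    (G : SimpleGraph V) [DecidableRel G.Adj]
    (htf : G.CliqueFree 3) (hdeg : ∀ v : V, G.degree v ≤ 3) :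
    ∃ c : V → Fin 3, ∀ u v, G.Adj u v → c u ≠ c v := by
  obtain ⟨c, hc⟩ := G.exists_properOn htf hdeg Finset.univ
  exact ⟨c, fun u v => hc u (Finset.mem_univ u) v (Finset.mem_univ v)⟩
end
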